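/- arXiv:1506.00764 — 2 statements merged into one kernel-verified Lean document; each statement's English description precedes it below -/
import Mathlib

section
/- Let f : EuclideanSpace ℝ (Fin 2) → ℝ be given by f(x) = -(1/2)·log(1 + ‖x‖²). Then f is smooth and for every x, -(1 + ‖x‖²) · (Δf)(x) = 2/(1 + ‖x‖²), where Δ denotes the Euclidean Laplacian. (This encodes that the cigar metric g_Σ = e^{2f}(dx² + dy²) = (dx² + dy²)/(1 + x² + y²) has Gauss curvature K = -e^{-2f}·Δf = 2/(1 + x² + y²).) -/
/-- The Euclidean Laplacian of a function on `EuclideanSpace ℝ (Fin 2)`: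
`Δ f x = ∑ i, ∂²f/∂xᵢ² (x)`. -/
noncomputable def euclideanLaplacian (f : EuclideanSpace ℝ (Fin 2) → ℝ)
    (x : EuclideanSpace ℝ (Fin 2)) : ℝ :=
  ∑ i : Fin 2,
    fderiv ℝ (fun y => fderiv ℝ f y (EuclideanSpace.single i 1)) x (EuclideanSpace.single i 1)

theorem cigar_conformal_factor_laplacian
    (f : EuclideanSpace ℝ (Fin 2) → ℝ)
    (hf : ∀ x, f x = -(1 / 2) * Real.log (1 + ‖x‖ ^ 2)) :
    ContDiff ℝ (⊤ : ℕ∞) f ∧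
      ∀ x, -(1 + ‖x‖ ^ 2) * euclideanLaplacian f x = 2 / (1 + ‖x‖ ^ 2) := by
  have hq : ∀ y : EuclideanSpace ℝ (Fin 2), (1 + ‖y‖ ^ 2) ≠ 0 := fun y => by positivity
  have hfe : f = fun x => -(1 / 2) * Real.log (1 + ‖x‖ ^ 2) := funext hf
  have hN : ∀ y : EuclideanSpace ℝ (Fin 2),
      HasFDerivAt (fun z : EuclideanSpace ℝ (Fin 2) => 1 + ‖z‖ ^ 2) (2 • innerSL ℝ y) y :=
    fun y => ((hasStrictFDerivAt_norm_sq y).hasFDerivAt).const_add 1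
  refine ⟨?_, fun x => ?_⟩
  · rw [hfe]
    exact contDiff_const.mul ((contDiff_const.add (contDiff_norm_sq ℝ)).log hq)
  · have h1 : ∀ (i : Fin 2) (y : EuclideanSpace ℝ (Fin 2)),
        fderiv ℝ f y (EuclideanSpace.single i 1) = -(y i) * (1 + ‖y‖ ^ 2)⁻¹ := by
      intro i y
      have h := ((hN y).log (hq y)).const_mul (-(1 / 2) : ℝ)
      rw [hfe, h.fderiv]
      simp [EuclideanSpace.inner_single_right]
      ring
    have h2 : ∀ i : Fin 2,
        fderiv ℝ (fun y => fderiv ℝ f y (EuclideanSpace.single i 1)) x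
          (EuclideanSpace.single i 1)
          = -(1 + ‖x‖ ^ 2)⁻¹ + 2 * (x i) ^ 2 * ((1 + ‖x‖ ^ 2) ^ 2)⁻¹ := by
      intro i
      simp only [h1]
      have ha : HasFDerivAt (fun y : EuclideanSpace ℝ (Fin 2) => y i)
          (EuclideanSpace.proj i : EuclideanSpace ℝ (Fin 2) →L[ℝ] ℝ) x :=
        (EuclideanSpace.proj i : EuclideanSpace ℝ (Fin 2) →L[ℝ] ℝ).hasFDerivAt
      have hb := (hasDerivAt_inv (hq x)).comp_hasFDerivAt x (hN x)
      have h := ha.neg.mul hb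
      have h' := h.fderiv
      simp only [Function.comp_def] at h'
      erw [h']
      simp [EuclideanSpace.inner_single_right]
      ring
    have hn : ‖x‖ ^ 2 = x 0 ^ 2 + x 1 ^ 2 := by
      simp [EuclideanSpace.norm_sq_eq]
    have hx := hq x
    simp only [euclideanLaplacian, h2, Fin.sum_univ_two]
    rw [hn] at hx ⊢
    field_simp
    ring
end

section
/- Let ρ(r) = r/√(1 + r²) and let u : ℝ → ℝ be differentiable on (0, 1) with u' differentiable on (0, 1). Suppose that u'(ρ(r)) = r for all r > 0. Then for all r > 0, the Gauss curvature expression of the radially symmetric graph satisfies (u''(ρ(r)) · u'(ρ(r)) · ρ(r)) / ((1 + u'(ρ(r))²)² · ρ(r)²) = 1. -/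
theorem cigar_gauss_curvature_is_one (ρ : ℝ → ℝ)
    (hρ : ∀ r, ρ r = r / Real.sqrt (1 + r ^ 2))
    (u : ℝ → ℝ) (hu : DifferentiableOn ℝ u (Set.Ioo 0 1))
    (hu' : DifferentiableOn ℝ (deriv u) (Set.Ioo 0 1))
    (h : ∀ r > (0 : ℝ), deriv u (ρ r) = r) :
    ∀ r > (0 : ℝ),
      deriv (deriv u) (ρ r) * deriv u (ρ r) * ρ r /
        ((1 + deriv u (ρ r) ^ 2) ^ 2 * ρ r ^ 2) = 1 := by
  intro r hr
  have hpos : 0 < 1 + r ^ 2 := by positivity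
  have hs : 0 < Real.sqrt (1 + r ^ 2) := Real.sqrt_pos.mpr hpos
  have hsq : Real.sqrt (1 + r ^ 2) ^ 2 = 1 + r ^ 2 := Real.sq_sqrt hpos.le
  have hmem : ρ r ∈ Set.Ioo (0 : ℝ) 1 := by
    rw [hρ]
    refine ⟨by positivity, ?_⟩
    rw [div_lt_one hs]
    exact Real.lt_sqrt_of_sq_lt (by linarith)
  have hd2 : HasDerivAt (deriv u) (deriv (deriv u) (ρ r)) (ρ r) :=
    ((hu' _ hmem).differentiableAt (isOpen_Ioo.mem_nhds hmem)).hasDerivAt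
  have hin : HasDerivAt (fun x : ℝ => 1 + x ^ 2) (2 * r) r := by
    simpa using (hasDerivAt_pow 2 r).const_add 1
  have hρd : HasDerivAt ρ (1 / Real.sqrt (1 + r ^ 2) ^ 3) r := by
    have h1 := (hasDerivAt_id r).div (hin.sqrt hpos.ne') hs.ne'
    have h2 : ρ = (id / fun x : ℝ => Real.sqrt (1 + x ^ 2)) := by
      funext x; simp [hρ]
    rw [h2]
    refine h1.congr_deriv ?_
    simp only [id]
    field_simp
    rw [hsq]; ring
  have hc := hd2.comp r hρd
  have hid : HasDerivAt (deriv u ∘ ρ) 1 r := by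
    refine (hasDerivAt_id r).congr_of_eventuallyEq ?_
    filter_upwards [lt_mem_nhds hr] with x hx
    exact h x hx
  have key := hc.unique hid
  rw [h r hr]
  have hD : deriv (deriv u) (ρ r) = Real.sqrt (1 + r ^ 2) ^ 3 := by
    field_simp at key
    linarith
  rw [hD, hρ, ← hsq]
  rw [hsq]
  field_simp
  rw [show Real.sqrt (1 + r ^ 2) ^ 4 = (Real.sqrt (1 + r ^ 2) ^ 2) ^ 2 by ring, hsq]
end
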